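/- arXiv:2308.02411 — 7 statements merged into one kernel-verified Lean document; each statement's English description precedes it below -/
import Mathlib

section
/- Let (L,[·,·],{·,·},α) be a compatible Hom-Leibniz algebra and (M,m_L^1,m_R^1,m_L^2,m_R^2,β) a compatible bimodule over it. Then L⊕M, with the linear map (α⊕β)(x,m) = (α(x),β(m)) and the two bilinear brackets [(x,u),(y,v)] := ([x,y], m_L^1(x,v) + m_R^1(u,y)) and {(x,u),(y,v)} := ({x,y}, m_L^2(x,v) + m_R^2(u,y)) for x,y ∈ L, u,v ∈ M, is a compatible Hom-Leibniz algebra. -/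
open Finset

variable {K : Type*} [Field K] [CharZero K]
variable {L : Type*} [AddCommGroup L] [Module K L]
variable {M : Type*} [AddCommGroup M] [Module K M]

/-- A bilinear map, phrased for plain curried functions. -/
def IsBilinMap (K : Type*) [Field K] {L M N : Type*} [AddCommGroup L] [Module K L]
    [AddCommGroup M] [Module K M] [AddCommGroup N] [Module K N] (b : L → M → N) : Prop :=
  (∀ x, IsLinearMap K (b x)) ∧ (∀ y, IsLinearMap K (fun x => b x y))

/-- A multiplicative Hom-Leibniz algebra structure `(L, b, α)`:
`α` linear, `b` bilinear, `α` multiplicative for `b`, and the Hom-Leibniz identity. -/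
def IsHomLeibniz (K : Type*) [Field K] {L : Type*} [AddCommGroup L] [Module K L]
    (α : L → L) (b : L → L → L) : Prop :=
  IsLinearMap K α ∧ IsBilinMap K b ∧
  (∀ x y, α (b x y) = b (α x) (α y)) ∧
  (∀ x y z, b (α x) (b y z) = b (b x y) (α z) + b (α y) (b x z))

/-- A compatible Hom-Leibniz algebra structure `(L, b₁, b₂, α)`. -/
def IsCompatibleHomLeibniz (K : Type*) [Field K] {L : Type*} [AddCommGroup L] [Module K L]
    (α : L → L) (b₁ b₂ : L → L → L) : Prop :=
  IsHomLeibniz K α b₁ ∧ IsHomLeibniz K α b₂ ∧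
  (∀ x y z, b₁ (α x) (b₂ y z) + b₂ (α x) (b₁ y z) =
    b₁ (b₂ x y) (α z) + b₂ (b₁ x y) (α z) + b₁ (α y) (b₂ x z) + b₂ (α y) (b₁ x z))

/-- A bimodule `(M, mL, mR, β)` over the multiplicative Hom-Leibniz algebra `(L, b, α)`. -/
def IsHomLeibnizBimodule (K : Type*) [Field K] {L M : Type*} [AddCommGroup L] [Module K L]
    [AddCommGroup M] [Module K M] (α : L → L) (b : L → L → L)
    (mL : L → M → M) (mR : M → L → M) (β : M → M) : Prop :=
  IsLinearMap K β ∧ IsBilinMap K mL ∧ IsBilinMap K mR ∧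
  (∀ x m, β (mL x m) = mL (α x) (β m)) ∧
  (∀ m x, β (mR m x) = mR (β m) (α x)) ∧
  (∀ x y m, mL (α x) (mL y m) = mL (b x y) (β m) + mL (α y) (mL x m)) ∧
  (∀ x y m, mL (α x) (mR m y) = mR (mL x m) (α y) + mR (β m) (b x y)) ∧
  (∀ x y m, mR (β m) (b x y) = mR (mR m x) (α y) + mL (α x) (mR m y))

/-- A compatible bimodule over the compatible Hom-Leibniz algebra `(L, b₁, b₂, α)`. -/
def IsCompatibleBimodule (K : Type*) [Field K] {L M : Type*} [AddCommGroup L] [Module K L]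
    [AddCommGroup M] [Module K M] (α : L → L) (b₁ b₂ : L → L → L)
    (mL₁ mL₂ : L → M → M) (mR₁ mR₂ : M → L → M) (β : M → M) : Prop :=
  IsHomLeibnizBimodule K α b₁ mL₁ mR₁ β ∧
  IsHomLeibnizBimodule K α b₂ mL₂ mR₂ β ∧
  (∀ x y m, mL₁ (α x) (mL₂ y m) + mL₂ (α x) (mL₁ y m) =
    mL₁ (b₂ x y) (β m) + mL₂ (b₁ x y) (β m) + mL₁ (α y) (mL₂ x m) + mL₂ (α y) (mL₁ x m)) ∧
  (∀ x y m, mL₁ (α x) (mR₂ m y) + mL₂ (α x) (mR₁ m y) =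
    mR₁ (mL₂ x m) (α y) + mR₂ (mL₁ x m) (α y) + mR₁ (β m) (b₂ x y) + mR₂ (β m) (b₁ x y)) ∧
  (∀ x y m, mR₁ (β m) (b₂ x y) + mR₂ (β m) (b₁ x y) =
    mR₁ (mR₂ m x) (α y) + mR₂ (mR₁ m x) (α y) + mL₁ (α x) (mR₂ m y) + mL₂ (α x) (mR₁ m y))

theorem IsBilinMap.semidirect {K L M : Type*} [Field K] [AddCommGroup L] [Module K L]
    [AddCommGroup M] [Module K M] {b : L → L → L}
    {mL : L → M → M} {mR : M → L → M}
    (hb : IsBilinMap K b) (hl : IsBilinMap K mL) (hr : IsBilinMap K mR) :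
    IsBilinMap K (fun p q : L × M => (b p.1 q.1, mL p.1 q.2 + mR p.2 q.1)) := by
  refine ⟨fun p => ⟨fun q r => Prod.ext ((hb.1 _).map_add _ _) ?_,
      fun c q => Prod.ext ((hb.1 _).map_smul _ _) ?_⟩,
    fun p => ⟨fun q r => Prod.ext ((hb.2 _).map_add _ _) ?_,
      fun c q => Prod.ext ((hb.2 _).map_smul _ _) ?_⟩⟩
  · simp only [Prod.fst_add, Prod.snd_add, (hl.1 _).map_add, (hr.1 _).map_add]
    abel
  · simp only [Prod.smul_fst, Prod.smul_snd, (hl.1 _).map_smul, (hr.1 _).map_smul, smul_add]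
  · simp only [Prod.fst_add, Prod.snd_add, (hl.2 _).map_add, (hr.2 _).map_add]
    abel
  · simp only [Prod.smul_fst, Prod.smul_snd, (hl.2 _).map_smul, (hr.2 _).map_smul, smul_add]

theorem IsHomLeibniz.semidirect {K L M : Type*} [Field K] [AddCommGroup L] [Module K L]
    [AddCommGroup M] [Module K M] {α : L → L}
    {b : L → L → L} {mL : L → M → M}
    {mR : M → L → M} {β : M → M} (h : IsHomLeibniz K α b)
    (hM : IsHomLeibnizBimodule K α b mL mR β) :
    IsHomLeibniz K (fun p : L × M => (α p.1, β p.2))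
      (fun p q : L × M => (b p.1 q.1, mL p.1 q.2 + mR p.2 q.1)) := by
  obtain ⟨hα, hb, hmul, hleib⟩ := h
  obtain ⟨hβ, hl, hr, hβl, hβr, hll, hlr, hrr⟩ := hM
  refine ⟨⟨fun p q => Prod.ext (hα.map_add _ _) (hβ.map_add _ _),
      fun c p => Prod.ext (hα.map_smul _ _) (hβ.map_smul _ _)⟩, hb.semidirect hl hr,
    fun p q => Prod.ext (hmul _ _) ?_, fun p q r => Prod.ext (hleib _ _ _) ?_⟩
  · simp only [hβ.map_add, hβl, hβr]
  · simp only [Prod.snd_add, (hl.1 _).map_add, (hr.2 _).map_add]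
    rw [hll, hlr, hrr q.1 r.1 p.2]
    abel

/-- The semi-direct product of a compatible Hom-Leibniz algebra
with a compatible bimodule is a compatible Hom-Leibniz algebra. -/
theorem semidirect_product_isCompatibleHomLeibniz
    (α : L → L) (b₁ b₂ : L → L → L) (mL₁ mL₂ : L → M → M) (mR₁ mR₂ : M → L → M)
    (β : M → M) (hL : IsCompatibleHomLeibniz K α b₁ b₂)
    (hM : IsCompatibleBimodule K α b₁ b₂ mL₁ mL₂ mR₁ mR₂ β) :
    IsCompatibleHomLeibniz K (fun p : L × M => (α p.1, β p.2))
      (fun p q : L × M => (b₁ p.1 q.1, mL₁ p.1 q.2 + mR₁ p.2 q.1))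
      (fun p q : L × M => (b₂ p.1 q.1, mL₂ p.1 q.2 + mR₂ p.2 q.1)) := by
  obtain ⟨h₁, h₂, hcomp⟩ := hL
  obtain ⟨hM₁, hM₂, hll, hlr, hrr⟩ := hM
  refine ⟨h₁.semidirect hM₁, h₂.semidirect hM₂, fun p q r => Prod.ext (hcomp _ _ _) ?_⟩
  obtain ⟨-, hl₁, hr₁, -⟩ := hM₁
  obtain ⟨-, hl₂, hr₂, -⟩ := hM₂
  simp only [Prod.snd_add, (hl₁.1 _).map_add, (hr₁.2 _).map_add, (hl₂.1 _).map_add,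
    (hr₂.2 _).map_add]
  grind only [hll p.1 q.1 r.2, hlr p.1 r.1 q.2, hrr q.1 r.1 p.2]
end

section
/- Let (L,α) be a K-vector space with linear map α and let π_1, π_2 ∈ C_α^2(L,L). Then (L,π_1,π_2,α) is a compatible Hom-Leibniz algebra if and only if [π_1,π_1]_B = 0, [π_2,π_2]_B = 0 and [π_1,π_2]_B = 0, i.e. if and only if (π_1,π_2) is a Maurer–Cartan element of the bi-differential graded Lie algebra (C_α^*(L,L), [·,·]_B, δ_1 = 0, δ_2 = 0). -/
open Finset

variable {K : Type*} [Field K] [CharZero K]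
variable {L : Type*} [AddCommGroup L] [Module K L]
variable {M : Type*} [AddCommGroup M] [Module K M]

/-- `σ` is an `(i, m-i)`-shuffle. -/
def IsShuffle {m : ℕ} (i : ℕ) (σ : Equiv.Perm (Fin m)) : Prop :=
  (∀ a b : Fin m, a < b → (b : ℕ) < i → σ a < σ b) ∧
  (∀ a b : Fin m, a < b → i ≤ (a : ℕ) → σ a < σ b)

instance {m : ℕ} (i : ℕ) (σ : Equiv.Perm (Fin m)) : Decidable (IsShuffle i σ) := by
  unfold IsShuffle; infer_instance

/-- The circle product `P ∘ Q = Σ_{k=1}^{p+1} (−1)^{(k−1)q} P∘_k Q` of Balavoine, where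
`(P∘_k Q)(x_1,…,x_{p+q+1}) = Σ_{σ ∈ S(k−1,q)} (−1)^σ P(α^p x_{σ(1)},…,α^p x_{σ(k−1)},
Q(x_{σ(k)},…,x_{σ(k+q−1)},x_{k+q}), α^p x_{k+q+1},…,α^p x_{p+q+1})`. -/
noncomputable def hcomp (α : L → L) (p q : ℕ)
    (P : (Fin (p + 1) → L) → L) (Q : (Fin (q + 1) → L) → L) :
    (Fin (p + q + 1) → L) → L :=
  fun x => ∑ j : Fin (p + 1), (-1 : ℤ) ^ ((j : ℕ) * q) •
    ∑ σ ∈ Finset.univ.filter (fun σ : Equiv.Perm (Fin ((j : ℕ) + q)) => IsShuffle (j : ℕ) σ),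
      ((Equiv.Perm.sign σ : ℤ)) •
        P (fun i : Fin (p + 1) =>
          if h : (i : ℕ) < (j : ℕ) then
            α^[p] (x (Fin.castLE (by have := j.isLt; omega)
              (σ ⟨(i : ℕ), by have := j.isLt; omega⟩)))
          else if (i : ℕ) = (j : ℕ) then
            Q (fun a : Fin (q + 1) =>
              if ha : (a : ℕ) < q then
                x (Fin.castLE (by have := j.isLt; omega)
                  (σ ⟨(j : ℕ) + (a : ℕ), by omega⟩))
              else x ⟨(j : ℕ) + q, by have := j.isLt; omega⟩)
          else α^[p] (x ⟨(i : ℕ) + q, by have := i.isLt; omega⟩))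

/-- Reindexing a cochain along an equality of arities. -/
def recast {m n : ℕ} (h : m = n) (f : (Fin m → L) → L) : (Fin n → L) → L :=
  fun x => f (fun i => x (Fin.cast h i))

/-- The Balavoine bracket `[P,Q]_B = P∘Q − (−1)^{pq} Q∘P` for `P` of degree `p`
(arity `p+1`) and `Q` of degree `q` (arity `q+1`). -/
noncomputable def balavoine (α : L → L) (p q : ℕ)
    (P : (Fin (p + 1) → L) → L) (Q : (Fin (q + 1) → L) → L) :
    (Fin (p + q + 1) → L) → L :=
  hcomp α p q P Q - ((-1 : ℤ) ^ (p * q)) • recast (by omega) (hcomp α q p Q P)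

/-- View a bilinear operation as a 2-cochain. -/
def c2 {L : Type*} (b : L → L → L) : (Fin 2 → L) → L := fun x => b (x 0) (x 1)

theorem sum_shuffles_zero_one (f : Equiv.Perm (Fin (0 + 1)) → L) :
    ∑ σ ∈ Finset.univ.filter (fun σ : Equiv.Perm (Fin (0 + 1)) => IsShuffle 0 σ), f σ = f 1 := by
  have h : Finset.univ.filter (fun σ : Equiv.Perm (Fin (0 + 1)) => IsShuffle 0 σ) = {1} := by
    decide
  rw [h, Finset.sum_singleton]

theorem sum_shuffles_one_one (f : Equiv.Perm (Fin (1 + 1)) → L) :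
    ∑ σ ∈ Finset.univ.filter (fun σ : Equiv.Perm (Fin (1 + 1)) => IsShuffle 1 σ), f σ =
      f 1 + f (Equiv.swap 0 1) := by
  have h : Finset.univ.filter (fun σ : Equiv.Perm (Fin (1 + 1)) => IsShuffle 1 σ) =
      {1, Equiv.swap 0 1} := by
    decide
  rw [h, Finset.sum_pair (by decide)]

/-- The circle product of two bilinear operations. -/
theorem hcomp_c2 (α : L → L) (b c : L → L → L) (x : Fin 3 → L) :
    hcomp α 1 1 (c2 b) (c2 c) x =
      b (c (x 0) (x 1)) (α (x 2)) - b (α (x 0)) (c (x 1) (x 2))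
        + b (α (x 1)) (c (x 0) (x 2)) := by
  unfold hcomp
  rw [Fin.sum_univ_two]
  erw [sum_shuffles_zero_one, sum_shuffles_one_one]
  simp [c2]
  abel

/-- The Balavoine bracket of two bilinear operations. -/
theorem balavoine_c2_eq_zero_iff (α : L → L) (b c : L → L → L) :
    balavoine α 1 1 (c2 b) (c2 c) = 0 ↔
      ∀ x y z, b (α x) (c y z) + c (α x) (b y z) =
        b (c x y) (α z) + c (b x y) (α z) + b (α y) (c x z) + c (α y) (b x z) := by
  have key : ∀ x : Fin 3 → L, balavoine α 1 1 (c2 b) (c2 c) x =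
      b (c (x 0) (x 1)) (α (x 2)) + c (b (x 0) (x 1)) (α (x 2))
        + b (α (x 1)) (c (x 0) (x 2)) + c (α (x 1)) (b (x 0) (x 2))
        - (b (α (x 0)) (c (x 1) (x 2)) + c (α (x 0)) (b (x 1) (x 2))) := by
    intro x
    have e : balavoine α 1 1 (c2 b) (c2 c) x =
        hcomp α 1 1 (c2 b) (c2 c) x - ((-1 : ℤ) ^ (1 * 1)) • hcomp α 1 1 (c2 c) (c2 b) x := rfl
    rw [e, hcomp_c2, hcomp_c2, mul_one, pow_one, neg_one_zsmul]
    abel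
  constructor
  · intro h x y z
    have hxyz := (key ![x, y, z]).symm.trans (congrFun h ![x, y, z])
    exact (sub_eq_zero.mp hxyz).symm
  · intro h
    funext x
    exact (key x).trans (sub_eq_zero.mpr (h (x 0) (x 1) (x 2)).symm)

/-- The self-bracket of a bilinear operation vanishes iff the Hom-Leibniz identity holds. -/
theorem balavoine_c2_self_eq_zero_iff (K : Type*) [Field K] [CharZero K] {L : Type*}
    [AddCommGroup L] [Module K L] (α : L → L) (b : L → L → L) :
    balavoine α 1 1 (c2 b) (c2 b) = 0 ↔
      ∀ x y z, b (α x) (b y z) = b (b x y) (α z) + b (α y) (b x z) := by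
  rw [balavoine_c2_eq_zero_iff]
  refine forall_congr' fun x => forall_congr' fun y => forall_congr' fun z => ?_
  have h2 : ∀ u : L, u + u = 0 ↔ u = 0 := fun u => by
    rw [← two_smul K u, smul_eq_zero, or_iff_right two_ne_zero]
  rw [← sub_eq_zero, ← sub_eq_zero (a := b (α x) (b y z)), ← h2 (b (α x) (b y z) - _)]
  refine iff_of_eq (congrArg (· = 0) ?_)
  abel

/-- `(L,π₁,π₂,α)` is a compatible Hom-Leibniz algebra iff
`[π₁,π₁]_B = 0`, `[π₂,π₂]_B = 0` and `[π₁,π₂]_B = 0`, i.e. iff `(π₁,π₂)` is a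
Maurer–Cartan element of the b-dgLa `(C_α^*(L,L), [·,·]_B, 0, 0)`. -/
theorem compatibleHomLeibniz_iff_maurerCartan
    (α : L → L) (hα : IsLinearMap K α) (π₁ π₂ : L → L → L)
    (h₁ : IsBilinMap K π₁) (h₂ : IsBilinMap K π₂)
    (hc₁ : ∀ x y, α (π₁ x y) = π₁ (α x) (α y))
    (hc₂ : ∀ x y, α (π₂ x y) = π₂ (α x) (α y)) :
    IsCompatibleHomLeibniz K α π₁ π₂ ↔
      (balavoine α 1 1 (c2 π₁) (c2 π₁) = 0 ∧ balavoine α 1 1 (c2 π₂) (c2 π₂) = 0 ∧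
        balavoine α 1 1 (c2 π₁) (c2 π₂) = 0) := by
  simp only [IsCompatibleHomLeibniz, IsHomLeibniz, balavoine_c2_self_eq_zero_iff K,
    balavoine_c2_eq_zero_iff]
  exact ⟨fun ⟨h, h', hc⟩ => ⟨h.2.2.2, h'.2.2.2, hc⟩,
    fun ⟨h, h', hc⟩ => ⟨⟨hα, h₁, hc₁, h⟩, ⟨hα, h₂, hc₂, h'⟩, hc⟩⟩
end

section
/- Let (L,μ_0,m_0,α) be a compatible Hom-Leibniz algebra and let (L,μ_t,m_t,α) and (L,μ_t',m_t',α) be two infinitesimal deformations (μ_t = μ_0 + tμ_1, m_t = m_0 + tm_1, μ_t' = μ_0 + tμ_1', m_t' = m_0 + tm_1'). If they are equivalent, i.e. there is a linear bijection N : L → L such that Id + tN : (L,μ_t,m_t,α) → (L,μ_t',m_t',α) is a compatible Hom-Leibniz algebra homomorphism for all t, then μ_1(x,y) − μ_1'(x,y) = [x,N(y)] + [N(x),y] − N([x,y]) and m_1(x,y) − m_1'(x,y) = {x,N(y)} + {N(x),y} − N({x,y}) for all x,y ∈ L, where [·,·] = μ_0 and {·,·} = m_0; that is, (μ_1 − μ_1',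 m_1 − m_1') = d^1 N = ([μ_0,N]_B, [m_0,N]_B), so (μ_1,m_1) and (μ_1',m_1') lie in the same second cohomology class. -/
open Finset

variable {K : Type*} [Field K] [CharZero K]
variable {L : Type*} [AddCommGroup L] [Module K L]
variable {M : Type*} [AddCommGroup M] [Module K M]

/-- A homomorphism of compatible Hom-Leibniz algebras
`φ : (L, b₁, c₁, α₁) → (L', b₂, c₂, α₂)`. -/
def IsCompatHom (K : Type*) [Field K] {L L' : Type*} [AddCommGroup L] [Module K L]
    [AddCommGroup L'] [Module K L'] (α₁ : L → L) (α₂ : L' → L')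
    (b₁ c₁ : L → L → L) (b₂ c₂ : L' → L' → L') (φ : L → L') : Prop :=
  IsLinearMap K φ ∧
  (∀ x y, φ (b₁ x y) = b₂ (φ x) (φ y)) ∧
  (∀ x y, φ (c₁ x y) = c₂ (φ x) (φ y)) ∧
  (∀ x, φ (α₁ x) = α₂ (φ x))

/-- The linear coefficient of a cubic polynomial with vector coefficients vanishes
if the polynomial vanishes at `1`, `-1` and `2`. -/
theorem eq_zero_of_forall_cubic_eq_zero {A B C : L}
    (h : ∀ t : K, t • A + t ^ 2 • B + t ^ 3 • C = 0) : A = 0 := by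
  linear_combination (norm := module) h 1 - (1 / 3 : K) • h (-1) - (1 / 6 : K) • h 2

/-- If `Id + tN` intertwines `b₀ + t b₁` and `b₀ + t b₁'` for all `t`,
then `b₁ - b₁'` is the Balavoine bracket of `b₀` with `N`. -/
theorem sub_eq_balavoine_of_forall_intertwining {b₀ b₁ b₁' : L → L → L} {N : L → L}
    (hb₀ : IsBilinMap K b₀) (hb₁' : IsBilinMap K b₁') (hN : IsLinearMap K N)
    (h : ∀ (t : K) (x y : L), b₀ x y + t • b₁ x y + t • N (b₀ x y + t • b₁ x y) =
      b₀ (x + t • N x) (y + t • N y) + t • b₁' (x + t • N x) (y + t • N y))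
    (x y : L) : b₁ x y - b₁' x y = b₀ x (N y) + b₀ (N x) y - N (b₀ x y) := by
  have expand {b : L → L → L} (hb : IsBilinMap K b) (t : K) :
      b (x + t • N x) (y + t • N y) =
        b x y + t • b x (N y) + t • b (N x) y + t ^ 2 • b (N x) (N y) := by
    rw [(hb.2 _).map_add, (hb.2 _).map_smul, (hb.1 x).map_add, (hb.1 x).map_smul,
      (hb.1 (N x)).map_add, (hb.1 (N x)).map_smul]
    module
  rw [← sub_eq_zero]
  refine eq_zero_of_forall_cubic_eq_zero (K := K)
    (B := N (b₁ x y) - b₀ (N x) (N y) - b₁' x (N y) - b₁' (N x) y)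
    (C := -b₁' (N x) (N y)) fun t => ?_
  have ht := h t x y
  rw [expand hb₀, expand hb₁', hN.map_add, hN.map_smul] at ht
  linear_combination (norm := module) ht

/-- If two infinitesimal deformations of a compatible
Hom-Leibniz algebra are equivalent via `Id + tN`, then
`μ₁ − μ₁' = [μ₀,N]_B` and `m₁ − m₁' = [m₀,N]_B`, i.e.
`(μ₁ − μ₁', m₁ − m₁') = d¹N`, so the two 2-cocycles lie in the same cohomology
class. -/
theorem equivalent_deformations_cohomologous
    (α : L → L) (μ₀ m₀ : L → L → L) (h : IsCompatibleHomLeibniz K α μ₀ m₀)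
    (μ₁ m₁ μ₁' m₁' : L → L → L)
    (hμ : IsBilinMap K μ₁) (hm : IsBilinMap K m₁)
    (hμ' : IsBilinMap K μ₁') (hm' : IsBilinMap K m₁')
    (hcμ : ∀ x y, α (μ₁ x y) = μ₁ (α x) (α y))
    (hcm : ∀ x y, α (m₁ x y) = m₁ (α x) (α y))
    (hcμ' : ∀ x y, α (μ₁' x y) = μ₁' (α x) (α y))
    (hcm' : ∀ x y, α (m₁' x y) = m₁' (α x) (α y))
    (hdef : ∀ t : K, IsCompatibleHomLeibniz K α (fun x y => μ₀ x y + t • μ₁ x y)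
        (fun x y => m₀ x y + t • m₁ x y))
    (hdef' : ∀ t : K, IsCompatibleHomLeibniz K α (fun x y => μ₀ x y + t • μ₁' x y)
        (fun x y => m₀ x y + t • m₁' x y))
    (N : L → L) (hN : IsLinearMap K N) (hNbij : Function.Bijective N)
    (hequiv : ∀ t : K, IsCompatHom K α α
        (fun x y => μ₀ x y + t • μ₁ x y) (fun x y => m₀ x y + t • m₁ x y)
        (fun x y => μ₀ x y + t • μ₁' x y) (fun x y => m₀ x y + t • m₁' x y)
        (fun z => z + t • N z)) :
    (∀ x y, μ₁ x y - μ₁' x y = μ₀ x (N y) + μ₀ (N x) y - N (μ₀ x y)) ∧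
    (∀ x y, m₁ x y - m₁' x y = m₀ x (N y) + m₀ (N x) y - N (m₀ x y)) := by
  exact ⟨sub_eq_balavoine_of_forall_intertwining h.1.2.1 hμ' hN fun t => (hequiv t).2.1,
    sub_eq_balavoine_of_forall_intertwining h.2.1.2.1 hm' hN fun t => (hequiv t).2.2.1⟩
end

section
/- Let N be a Nijenhuis operator on a multiplicative Hom-Leibniz algebra (L,[·,·],α). Then (L,[·,·]_N,α) with [x,y]_N = [x,N(y)] + [N(x),y] − N([x,y]) is a multiplicative Hom-Leibniz algebra, N is a Hom-Leibniz algebra homomorphism from (L,[·,·]_N,α) to (L,[·,·],α) (i.e. N([x,y]_N) = [N(x),N(y)] and N∘α = α∘N), and (L,[·,·],[·,·]_N,α) is a compatible Hom-Leibniz algebra. -/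
open Finset

variable {K : Type*} [Field K] [CharZero K]
variable {L : Type*} [AddCommGroup L] [Module K L]
variable {M : Type*} [AddCommGroup M] [Module K M]

/-- A Nijenhuis operator on a multiplicative Hom-Leibniz algebra `(L, b, α)`. -/
def IsNijenhuis (K : Type*) [Field K] {L : Type*} [AddCommGroup L] [Module K L]
    (α : L → L) (b : L → L → L) (N : L → L) : Prop :=
  IsLinearMap K N ∧ (∀ x, N (α x) = α (N x)) ∧
  (∀ x y, N (b x (N y) + b (N x) y - N (b x y)) = b (N x) (N y))

/-- The deformed bracket `[x,y]_N = b(x,Ny) + b(Nx,y) − N(b(x,y))`. -/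
def nijBracket {L : Type*} [AddCommGroup L] (b : L → L → L) (N : L → L) : L → L → L :=
  fun x y => b x (N y) + b (N x) y - N (b x y)

/-- For a Nijenhuis operator `N` on a multiplicative
Hom-Leibniz algebra `(L,[·,·],α)`: `(L,[·,·]_N,α)` is a multiplicative
Hom-Leibniz algebra, `N` is a homomorphism `(L,[·,·]_N,α) → (L,[·,·],α)`, and
`(L,[·,·],[·,·]_N,α)` is a compatible Hom-Leibniz algebra. -/
theorem nijenhuis_deformed_bracket
    (α : L → L) (b : L → L → L) (h : IsHomLeibniz K α b)
    (N : L → L) (hN : IsNijenhuis K α b N) :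
    IsHomLeibniz K α (nijBracket b N) ∧
    (∀ x y, N (nijBracket b N x y) = b (N x) (N y)) ∧
    (∀ x, N (α x) = α (N x)) ∧
    IsCompatibleHomLeibniz K α b (nijBracket b N) := by
  obtain ⟨hα, ⟨hb₁, hb₂⟩, hmul, hleib⟩ := h
  obtain ⟨hNlin, hNα, hNij⟩ := hN
  have addl : ∀ x y z, b (x + y) z = b x z + b y z := fun x y z => (hb₂ z).map_add x y
  have subl : ∀ x y z, b (x - y) z = b x z - b y z := fun x y z => (hb₂ z).map_sub x y
  have smull : ∀ (c : K) x z, b (c • x) z = c • b x z := fun c x z => (hb₂ z).map_smul c x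
  have addr : ∀ x y z, b x (y + z) = b x y + b x z := fun x => (hb₁ x).map_add
  have subr : ∀ x y z, b x (y - z) = b x y - b x z := fun x => (hb₁ x).map_sub
  have smulr : ∀ (c : K) x z, b x (c • z) = c • b x z := fun c x => (hb₁ x).map_smul c
  have hom : ∀ x y, N (nijBracket b N x y) = b (N x) (N y) := hNij
  have expand : ∀ x y, N (b x (N y)) + N (b (N x) y) - N (N (b x y)) = b (N x) (N y) := by
    intro x y
    rw [← hNij, hNlin.map_sub, hNlin.map_add]
  have leib : IsHomLeibniz K α (nijBracket b N) := by
    refine ⟨hα, ⟨fun x => ⟨fun y z => ?_, fun c y => ?_⟩,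
      fun x => ⟨fun y z => ?_, fun c y => ?_⟩⟩, fun x y => ?_, fun x y z => ?_⟩
    · simp only [nijBracket, addr, hNlin.map_add]
      abel
    · simp only [nijBracket, smulr, hNlin.map_smul]
      module
    · simp only [nijBracket, addl, hNlin.map_add]
      abel
    · simp only [nijBracket, smull, hNlin.map_smul]
      module
    · simp only [nijBracket, hα.map_add, hα.map_sub, hmul, ← hNα]
    · have outer : ∀ u v, nijBracket b N u v = b u (N v) + b (N u) v - N (b u v) :=
        fun _ _ => rfl
      rw [outer (α x), outer (nijBracket b N x y), outer (α y)]
      simp only [hom]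
      simp only [nijBracket, addl, subl, addr, subr, hNlin.map_add, hNlin.map_sub, hNα]
      have hN_leib : ∀ x y z, N (b (α x) (b y z)) =
          N (b (b x y) (α z)) + N (b (α y) (b x z)) := by
        intro x y z
        rw [hleib, hNlin.map_add]
      have hNN_leib : N (N (b (α x) (b y z))) =
          N (N (b (b x y) (α z))) + N (N (b (α y) (b x z))) := by
        rw [hN_leib, hNlin.map_add]
      have e₁ := expand (α x) (b y z)
      have e₂ := expand (b x y) (α z)
      have e₃ := expand (α y) (b x z)
      rw [hNα] at e₁ e₂ e₃
      linear_combination (norm := module) hleib x (N y) (N z) + hleib (N x) y (N z) +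
        hleib (N x) (N y) z - hN_leib x y (N z) - hN_leib x (N y) z - hN_leib (N x) y z +
        hNN_leib + e₁ - e₂ - e₃
  refine ⟨leib, hom, hNα, ⟨hα, ⟨hb₁, hb₂⟩, hmul, hleib⟩, leib, fun x y z => ?_⟩
  have hN_leib : N (b (α x) (b y z)) = N (b (b x y) (α z)) + N (b (α y) (b x z)) := by
    rw [hleib, hNlin.map_add]
  simp only [nijBracket, addl, subl, addr, subr, hNα]
  linear_combination (norm := module) hleib x y (N z) + hleib x (N y) z + hleib (N x) y z - hN_leib
end

section
/- Let (L,[·,·],{·,·},α) be a compatible Hom-Leibniz algebra and N : L → L a Nijenhuis operator on it. Then (L,[·,·]_N,{·,·}_N,α) is a compatible Hom-Leibniz algebra, where [x,y]_N = [x,N(y)] + [N(x),y] − N([x,y]) and {x,y}_N = {x,N(y)} + {N(x),y} − N({x,y}), and N is a compatible Hom-Leibniz algebra homomorphism from (L,[·,·]_N,{·,·}_N,α) to (L,[·,·],{·,·},α). -/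
open Finset

variable {K : Type*} [Field K] [CharZero K]
variable {L : Type*} [AddCommGroup L] [Module K L]
variable {M : Type*} [AddCommGroup M] [Module K M]

section

variable {F V : Type*} [Field F] [AddCommGroup V] [Module F V]

/-- The nested deformed bracket, bracketed to the right. -/
theorem nijBracket_nijBracket_right {α N : V → V} {b c : V → V → V}
    (hb : IsBilinMap F b) (hNb : IsNijenhuis F α b N) (hNc : IsNijenhuis F α c N) (u y z : V) :
    nijBracket b N u (nijBracket c N y z) =
      b u (c (N y) (N z)) + b (N u) (c y (N z)) + b (N u) (c (N y) z)
        - N (b (N u) (c y z) + b u (c y (N z)) + b u (c (N y) z))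
        + N (N (b u (c y z))) := by
  have h := hNb.2.2 u (c y z)
  simp only [nijBracket, hNc.2.2, (hb.1 _).map_sub, (hb.1 _).map_add, hNb.1.map_sub,
    hNb.1.map_add] at h ⊢
  rw [← h]
  abel

/-- The nested deformed bracket, bracketed to the left. -/
theorem nijBracket_nijBracket_left {α N : V → V} {b c : V → V → V}
    (hb : IsBilinMap F b) (hNb : IsNijenhuis F α b N) (hNc : IsNijenhuis F α c N) (x y u : V) :
    nijBracket b N (nijBracket c N x y) u =
      b (c (N x) (N y)) u + b (c x (N y)) (N u) + b (c (N x) y) (N u)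
        - N (b (c x y) (N u) + b (c x (N y)) u + b (c (N x) y) u)
        + N (N (b (c x y) u)) := by
  have h := hNb.2.2 (c x y) u
  have hadd (p q w : V) : b (p + q) w = b p w + b q w := (hb.2 w).map_add p q
  have hsub (p q w : V) : b (p - q) w = b p w - b q w := (hb.2 w).map_sub p q
  simp only [nijBracket, hNc.2.2, hadd, hsub, hNb.1.map_sub, hNb.1.map_add] at h ⊢
  rw [← h]
  abel

/-- A linear operator deforms a bilinear bracket into a bilinear bracket. -/
theorem IsBilinMap.nijBracket {N : V → V} {b : V → V → V}
    (hb : IsBilinMap F b) (hN : IsLinearMap F N) : IsBilinMap F (nijBracket b N) := by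
  have hadd (p q w : V) : b (p + q) w = b p w + b q w := (hb.2 w).map_add p q
  have hsmul (r : F) (p w : V) : b (r • p) w = r • b p w := (hb.2 w).map_smul r p
  refine ⟨fun x => ⟨fun y z => ?_, fun r y => ?_⟩, fun x => ⟨fun y z => ?_, fun r y => ?_⟩⟩ <;>
    simp only [_root_.nijBracket, hN.map_add, hN.map_smul, (hb.1 _).map_add, (hb.1 _).map_smul,
      hadd, hsmul] <;>
    module

/-- A Nijenhuis operator deforms a Hom-Leibniz bracket into a Hom-Leibniz bracket. -/
theorem IsHomLeibniz.nijBracket {α N : V → V} {b : V → V → V}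
    (h : IsHomLeibniz F α b) (hN : IsNijenhuis F α b N) :
    IsHomLeibniz F α (nijBracket b N) := by
  obtain ⟨hα, hb, hmul, hleib⟩ := h
  refine ⟨hα, hb.nijBracket hN.1, fun x y => ?_, fun x y z => ?_⟩
  · simp only [_root_.nijBracket, hα.map_add, hα.map_sub, hmul, ← hN.2.1]
  · simp only [nijBracket_nijBracket_right hb hN hN, nijBracket_nijBracket_left hb hN hN, hN.2.1]
    rw [hleib x (N y) (N z), hleib (N x) y (N z), hleib (N x) (N y) z,
      hleib (N x) y z, hleib x (N y) z, hleib x y (N z), hleib x y z]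
    simp only [hN.1.map_add]
    abel

/-- Deforming by a common Nijenhuis operator preserves the compatibility of two brackets. -/
theorem nijBracket_compatible {α N : V → V} {b c : V → V → V}
    (hb : IsBilinMap F b) (hc : IsBilinMap F c)
    (hNb : IsNijenhuis F α b N) (hNc : IsNijenhuis F α c N)
    (hcompat : ∀ x y z, b (α x) (c y z) + c (α x) (b y z) =
      b (c x y) (α z) + c (b x y) (α z) + b (α y) (c x z) + c (α y) (b x z)) (x y z : V) :
    nijBracket b N (α x) (nijBracket c N y z) + nijBracket c N (α x) (nijBracket b N y z) =
      nijBracket b N (nijBracket c N x y) (α z) + nijBracket c N (nijBracket b N x y) (α z) +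
        nijBracket b N (α y) (nijBracket c N x z) + nijBracket c N (α y) (nijBracket b N x z) := by
  have hcompat' (x y z : V) : b (α x) (c y z) =
      b (c x y) (α z) + c (b x y) (α z) + b (α y) (c x z) + c (α y) (b x z)
        - c (α x) (b y z) := eq_sub_of_add_eq (hcompat x y z)
  simp only [nijBracket_nijBracket_right hb hNb hNc, nijBracket_nijBracket_left hb hNb hNc,
    nijBracket_nijBracket_right hc hNc hNb, nijBracket_nijBracket_left hc hNc hNb, hNb.2.1]
  rw [hcompat' x (N y) (N z), hcompat' (N x) y (N z), hcompat' (N x) (N y) z,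
    hcompat' (N x) y z, hcompat' x (N y) z, hcompat' x y (N z), hcompat' x y z]
  simp only [hNb.1.map_add, hNb.1.map_sub]
  abel

end

/-- If `N` is a Nijenhuis operator on the compatible Hom-Leibniz
algebra `(L,b₁,b₂,α)`, then `(L,(b₁)_N,(b₂)_N,α)` is a compatible Hom-Leibniz
algebra and `N` is a homomorphism `(L,(b₁)_N,(b₂)_N,α) → (L,b₁,b₂,α)`. -/
theorem nijenhuis_deformed_compatible
    (α : L → L) (b₁ b₂ : L → L → L) (h : IsCompatibleHomLeibniz K α b₁ b₂)
    (N : L → L) (hN₁ : IsNijenhuis K α b₁ N) (hN₂ : IsNijenhuis K α b₂ N) :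
    IsCompatibleHomLeibniz K α (nijBracket b₁ N) (nijBracket b₂ N) ∧
    IsCompatHom K α α (nijBracket b₁ N) (nijBracket b₂ N) b₁ b₂ N := by
  obtain ⟨h₁, h₂, hcompat⟩ := h
  exact ⟨⟨h₁.nijBracket hN₁, h₂.nijBracket hN₂,
      nijBracket_compatible h₁.2.1 h₂.2.1 hN₁ hN₂ hcompat⟩,
    hN₁.1, hN₁.2.2, hN₂.2.2, hN₁.2.1⟩
end

section
/- Let (L,μ_0,m_0,α) be a compatible Hom-Leibniz algebra and (L,μ_t,m_t,α) an infinitesimal deformation generated by (μ_1,m_1). If the deformation is trivial, i.e. there exists a linear map N : L → L such that Id + tN : (L,μ_t,m_t,α) → (L,μ_0,m_0,α) is a compatible Hom-Leibniz algebra homomorphism for all t ∈ K, then N is a Nijenhuis operator on the compatible Hom-Leibniz algebra (L,μ_0,m_0,α); explicitly, N∘α = α∘N, μ_1(x,y) = μ_0(x,N(y)) + μ_0(N(x),y) − N(μ_0(x,y)) with N(μ_1(x,y)) = μ_0(N(x),N(y)), and m_1(x,y) = m_0(x,N(y)) + m_0(N(x),y) − N(m_0(x,y)) with N(m_1(x,y))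 = m_0(N(x),N(y)) for all x,y ∈ L. -/
open Finset

variable {K : Type*} [Field K] [CharZero K]
variable {L : Type*} [AddCommGroup L] [Module K L]
variable {M : Type*} [AddCommGroup M] [Module K M]

/-- The coefficients of `t` and `t ^ 2` in the condition that every `Id + tN` maps
`b₀ + t b₁` to `b₀`. -/
theorem eq_and_eq_of_forall_id_add_smul_map {K : Type*} [Field K] [CharZero K]
    {L : Type*} [AddCommGroup L] [Module K L] {b₀ b₁ : L → L → L} {N : L → L}
    (hb : IsBilinMap K b₀) (hN : IsLinearMap K N)
    (h : ∀ (t : K) (x y : L), b₀ x y + t • b₁ x y + t • N (b₀ x y + t • b₁ x y) =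
      b₀ (x + t • N x) (y + t • N y)) (x y : L) :
    b₁ x y = b₀ x (N y) + b₀ (N x) y - N (b₀ x y) ∧ N (b₁ x y) = b₀ (N x) (N y) := by
  have expand : ∀ t : K, t • (b₁ x y - (b₀ x (N y) + b₀ (N x) y - N (b₀ x y))) +
      (t * t) • (N (b₁ x y) - b₀ (N x) (N y)) = 0 := by
    intro t
    have ht := h t x y
    rw [(hb.1 _).map_add, (hb.1 _).map_smul, (hb.2 y).map_add, (hb.2 (N y)).map_add,
      (hb.2 y).map_smul, (hb.2 (N y)).map_smul, hN.map_add, hN.map_smul] at ht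
    rw [← sub_eq_zero] at ht
    rw [← ht]
    module
  have h_pos := expand 1
  have h_neg := expand (-1)
  have quadratic : N (b₁ x y) - b₀ (N x) (N y) = 0 := by
    have two_smul_eq : (2 : K) • (N (b₁ x y) - b₀ (N x) (N y)) = 0 := by
      rw [← add_zero (0 : L)]
      nth_rewrite 1 [← h_pos]
      rw [← h_neg]
      module
    exact (smul_eq_zero.mp two_smul_eq).resolve_left two_ne_zero
  refine ⟨sub_eq_zero.mp ?_, sub_eq_zero.mp quadratic⟩
  simpa [quadratic] using h_pos

/-- A trivial infinitesimal deformation of a compatible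
Hom-Leibniz algebra gives rise to a Nijenhuis operator: if `Id + tN` is a
homomorphism `(L,μ_t,m_t,α) → (L,μ₀,m₀,α)` for all `t`, then `N` is a Nijenhuis
operator on both `(L,μ₀,α)` and `(L,m₀,α)`, and the displayed identities hold. -/
theorem trivial_deformation_gives_nijenhuis
    (α : L → L) (μ₀ m₀ : L → L → L) (h : IsCompatibleHomLeibniz K α μ₀ m₀)
    (μ₁ m₁ : L → L → L) (hμ : IsBilinMap K μ₁) (hm : IsBilinMap K m₁)
    (hcμ : ∀ x y, α (μ₁ x y) = μ₁ (α x) (α y))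
    (hcm : ∀ x y, α (m₁ x y) = m₁ (α x) (α y))
    (hdef : ∀ t : K, IsCompatibleHomLeibniz K α (fun x y => μ₀ x y + t • μ₁ x y)
        (fun x y => m₀ x y + t • m₁ x y))
    (N : L → L) (hN : IsLinearMap K N)
    (htriv : ∀ t : K, IsCompatHom K α α
        (fun x y => μ₀ x y + t • μ₁ x y) (fun x y => m₀ x y + t • m₁ x y)
        μ₀ m₀ (fun z => z + t • N z)) :
    IsNijenhuis K α μ₀ N ∧ IsNijenhuis K α m₀ N ∧
    (∀ x, N (α x) = α (N x)) ∧
    (∀ x y, μ₁ x y = μ₀ x (N y) + μ₀ (N x) y - N (μ₀ x y)) ∧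
    (∀ x y, N (μ₁ x y) = μ₀ (N x) (N y)) ∧
    (∀ x y, m₁ x y = m₀ x (N y) + m₀ (N x) y - N (m₀ x y)) ∧
    (∀ x y, N (m₁ x y) = m₀ (N x) (N y)) := by
  have comm : ∀ x, N (α x) = α (N x) := by
    intro x
    have hx := (htriv 1).2.2.2 x
    simpa [h.1.1.map_add] using hx
  have key_μ := eq_and_eq_of_forall_id_add_smul_map h.1.2.1 hN fun t => (htriv t).2.1
  have key_m := eq_and_eq_of_forall_id_add_smul_map h.2.1.2.1 hN fun t => (htriv t).2.2.1
  refine ⟨⟨hN, comm, fun x y => ?_⟩, ⟨hN, comm, fun x y => ?_⟩, comm,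
    fun x y => (key_μ x y).1, fun x y => (key_μ x y).2,
    fun x y => (key_m x y).1, fun x y => (key_m x y).2⟩
  · rw [← (key_μ x y).1, (key_μ x y).2]
  · rw [← (key_m x y).1, (key_m x y).2]
end

section
/- Let (L,π,α) be a multiplicative Hom-Leibniz algebra, M a K-vector space with bilinear maps m_L : L × M → M, m_R : M × L → M and a linear map β : M → M. Then (M,m_L,m_R,β) is a bimodule over (L,π,α) if and only if the lift m̂_L + m̂_R is a Maurer–Cartan element of the differential graded Lie algebra (C_{α⊕β}^*(L⊕M, L⊕M), [·,·]_B, ∂_{π̂} = [π̂,·]_B), i.e. if and only if [π̂, m̂_L + m̂_R]_B + (1/2)[m̂_L + m̂_R, m̂_L + m̂_R]_B = 0. In particular, if (M,m_L,m_R,β) is a bimodule then [π̂ + m̂_L + m̂_R, π̂ + m̂_L + m̂_R]_B = 0. -/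
open Finset

variable {K : Type*} [Field K] [CharZero K]
variable {L : Type*} [AddCommGroup L] [Module K L]
variable {M : Type*} [AddCommGroup M] [Module K M]

/-- An `n`-multilinear map, phrased for plain functions. -/
def IsMultilin (K : Type*) [Field K] {L : Type*} [AddCommGroup L] [Module K L]
    {n : ℕ} (f : (Fin n → L) → L) : Prop :=
  ∀ (x : Fin n → L) (i : Fin n), IsLinearMap K (fun v => f (Function.update x i v))

/-- Membership condition for `C_α^n(L,L)`: the map commutes with `α`,
i.e. `α ∘ f = f ∘ α^{⊗n}`. -/
def CommutesWith {L : Type*} (α : L → L) {n : ℕ} (f : (Fin n → L) → L) : Prop :=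
  ∀ x, α (f x) = f (fun i => α (x i))

/-- Lift of the multiplication `π : L⊗L → L` to a 2-cochain on `L ⊕ M`. -/
def hatPi {L M : Type*} [AddCommGroup L] [AddCommGroup M] (b : L → L → L) :
    (Fin 2 → L × M) → L × M := fun x => (b (x 0).1 (x 1).1, 0)

/-- Lift of the left action `m_L : L⊗M → M` to a 2-cochain on `L ⊕ M`. -/
def hatML {L M : Type*} [AddCommGroup L] [AddCommGroup M] (mL : L → M → M) :
    (Fin 2 → L × M) → L × M := fun x => (0, mL (x 0).1 (x 1).2)

/-- Lift of the right action `m_R : M⊗L → M` to a 2-cochain on `L ⊕ M`. -/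
def hatMR {L M : Type*} [AddCommGroup L] [AddCommGroup M] (mR : M → L → M) :
    (Fin 2 → L × M) → L × M := fun x => (0, mR (x 0).2 (x 1).1)

theorem sum_isShuffle_one_one {A : Type*} [AddCommGroup A]
    (f : Equiv.Perm (Fin 2) → A) :
    ∑ σ ∈ univ.filter (fun σ : Equiv.Perm (Fin 2) => IsShuffle 1 σ), f σ
      = f 1 + f (Equiv.swap 0 1) := by
  have hs : univ.filter (fun σ : Equiv.Perm (Fin 2) => IsShuffle 1 σ)
      = {1, Equiv.swap 0 1} := by decide
  rw [hs, sum_pair (by decide)]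

theorem sum_isShuffle_zero_one {A : Type*} [AddCommGroup A]
    (f : Equiv.Perm (Fin (0 + 1)) → A) :
    ∑ σ ∈ univ.filter (fun σ : Equiv.Perm (Fin (0 + 1)) => IsShuffle 0 σ), f σ = f 1 := by
  have hs : univ.filter (fun σ : Equiv.Perm (Fin (0 + 1)) => IsShuffle 0 σ) = {1} := by decide
  rw [hs, sum_singleton]

/-- The circle product of two 2-cochains. -/
theorem hcomp_one_one {A : Type*} [AddCommGroup A] (α : A → A) (P Q : (Fin 2 → A) → A)
    (x : Fin 3 → A) :
    hcomp α 1 1 P Q x = P ![Q ![x 0, x 1], α (x 2)]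
      - (P ![α (x 0), Q ![x 1, x 2]] - P ![α (x 1), Q ![x 0, x 2]]) := by
  have eta : ∀ g : Fin 2 → A, g = ![g 0, g 1] := fun g => by
    ext i; fin_cases i <;> rfl
  unfold hcomp
  rw [Fin.sum_univ_two]
  erw [sum_isShuffle_zero_one, sum_isShuffle_one_one]
  have h₁ : ((Equiv.Perm.sign (1 : Equiv.Perm (Fin 2)) : ℤˣ) : ℤ) = 1 := by simp
  have h₂ : ((Equiv.Perm.sign (Equiv.swap (0 : Fin 2) 1) : ℤˣ) : ℤ) = -1 := by decide
  have e₀ : (-1 : ℤ) ^ (((0 : Fin 2) : ℕ) * 1) = 1 := by decide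
  have e₁ : (-1 : ℤ) ^ (((1 : Fin 2) : ℕ) * 1) = -1 := by decide
  erw [h₁, h₂, e₀, e₁]
  rw [one_smul, one_smul, one_smul, neg_one_smul, neg_one_smul, ← sub_eq_add_neg,
    ← sub_eq_add_neg]
  refine congrArg₂ _ (congrArg P ?_) (congrArg₂ _ (congrArg P ?_) (congrArg P ?_)) <;>
    refine (eta _).trans (congrArg₂ (fun a c : A => ![a, c]) ?_ ?_)
  · exact congrArg Q (eta _)
  · rfl
  · rfl
  · exact congrArg Q (eta _)
  · rfl
  · exact congrArg Q (eta _)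

theorem balavoine_one_one {A : Type*} [AddCommGroup A] (α : A → A) (P Q : (Fin 2 → A) → A)
    (x : Fin 3 → A) :
    balavoine α 1 1 P Q x = hcomp α 1 1 P Q x + hcomp α 1 1 Q P x := by
  simp [balavoine, recast]

/-- `(M,m_L,m_R,β)` is a bimodule over the multiplicative
Hom-Leibniz algebra `(L,π,α)` iff the lift `m̂_L + m̂_R` is a Maurer–Cartan
element of the dgLa `(C_{α⊕β}^*(L⊕M,L⊕M), [·,·]_B, ∂_{π̂} = [π̂,·]_B)`, i.e.
iff it lies in `C_{α⊕β}^2` and `[π̂, m̂_L+m̂_R]_B + ½[m̂_L+m̂_R, m̂_L+m̂_R]_B = 0`.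
In particular, if it is a bimodule then `[π̂+m̂_L+m̂_R, π̂+m̂_L+m̂_R]_B = 0`. -/
theorem bimodule_iff_maurerCartan
    (α : L → L) (b : L → L → L) (h : IsHomLeibniz K α b)
    (mL : L → M → M) (mR : M → L → M) (β : M → M)
    (hmL : IsBilinMap K mL) (hmR : IsBilinMap K mR) (hβ : IsLinearMap K β) :
    (IsHomLeibnizBimodule K α b mL mR β ↔
      (CommutesWith (fun p : L × M => (α p.1, β p.2)) (hatML mL + hatMR mR) ∧
        balavoine (fun p : L × M => (α p.1, β p.2)) 1 1 (hatPi b) (hatML mL + hatMR mR)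
          + (2⁻¹ : K) • balavoine (fun p : L × M => (α p.1, β p.2)) 1 1
              (hatML mL + hatMR mR) (hatML mL + hatMR mR) = 0)) ∧
    (IsHomLeibnizBimodule K α b mL mR β →
      balavoine (fun p : L × M => (α p.1, β p.2)) 1 1
          (hatPi b + hatML mL + hatMR mR) (hatPi b + hatML mL + hatMR mR) = 0) := by
  have b0 : ∀ z, b 0 z = 0 := fun z => (h.2.1.2 z).map_zero
  have b0' : ∀ z, b z 0 = 0 := fun z => (h.2.1.1 z).map_zero
  have l0 : ∀ z, mL 0 z = 0 := fun z => (hmL.2 z).map_zero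
  have l0' : ∀ z, mL z 0 = 0 := fun z => (hmL.1 z).map_zero
  have r0 : ∀ z, mR 0 z = 0 := fun z => (hmR.2 z).map_zero
  have r0' : ∀ z, mR z 0 = 0 := fun z => (hmR.1 z).map_zero
  have la : ∀ x u v, mL x (u + v) = mL x u + mL x v := fun x => (hmL.1 x).map_add
  have ra : ∀ u v x, mR (u + v) x = mR u x + mR v x := fun u v x => (hmR.2 x).map_add u v
  have α0 : α 0 = 0 := h.1.map_zero
  have β0 : β 0 = 0 := hβ.map_zero
  have βa := hβ.map_add
  have half : ∀ p : L × M, (2⁻¹ : K) • (p + p) = p := fun p => by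
    rw [← two_smul K p, smul_smul, inv_mul_cancel₀ two_ne_zero, one_smul]
  set T : L × M → L × M := fun p => (α p.1, β p.2) with hT
  set E : L → L → L → M → M → M → M := fun x y z u v w =>
    mL (b x y) (β w) - mR (β u) (b y z) + mR (β v) (b x z)
      + (mR (mL x v) (α z) + mR (mR u y) (α z))
      - (mL (α x) (mL y w) + mL (α x) (mR v z))
      + (mL (α y) (mL x w) + mL (α y) (mR u z)) with hE
  have key : ∀ x : Fin 3 → L × M,
      hcomp T 1 1 (hatPi b) (hatML mL + hatMR mR) x
        + hcomp T 1 1 (hatML mL + hatMR mR) (hatPi b) x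
        + hcomp T 1 1 (hatML mL + hatMR mR) (hatML mL + hatMR mR) x
      = (0, E (x 0).1 (x 1).1 (x 2).1 (x 0).2 (x 1).2 (x 2).2) := by
    intro x
    ext
    · simp [hcomp_one_one, hatPi, hatML, hatMR, b0, b0']
    · simp [hcomp_one_one, hatPi, hatML, hatMR, l0, l0', r0, r0', la, ra, hE, hT]
      abel
  have key' : ∀ x : Fin 3 → L × M,
      hcomp T 1 1 (hatPi b + hatML mL + hatMR mR) (hatPi b + hatML mL + hatMR mR) x
      = (0, E (x 0).1 (x 1).1 (x 2).1 (x 0).2 (x 1).2 (x 2).2) := by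
    intro x
    ext
    · simp [hcomp_one_one, hatPi, hatML, hatMR, hT, h.2.2.2 (x 0).1]
    · simp [hcomp_one_one, hatPi, hatML, hatMR, la, ra, hE, hT]
      abel
  have hE0 : IsHomLeibnizBimodule K α b mL mR β → ∀ x y z u v w, E x y z u v w = 0 := by
    rintro ⟨-, -, -, -, -, c3, c4, c5⟩ x y z u v w
    simp only [hE]
    rw [c3 x y w, c4 x z v, c5 y z u]
    abel
  refine ⟨⟨fun hB => ⟨fun x => ?_, funext fun x => ?_⟩, ?_⟩, fun hB => funext fun x => ?_⟩
  · simp [hT, hatML, hatMR, α0, βa, hB.2.2.2.1, hB.2.2.2.2.1]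
  · have := key x
    rw [hE0 hB, Prod.mk_zero_zero] at this
    simpa [balavoine_one_one, half] using this
  · rintro ⟨hc, hm⟩
    have hc' : ∀ x y u v, β (mL x v + mR u y) = mL (α x) (β v) + mR (β u) (α y) := by
      intro x y u v
      simpa [hatML, hatMR, hT] using congrArg Prod.snd (hc ![(x, u), (y, v)])
    have hm' : ∀ x y z u v w, E x y z u v w = 0 := by
      intro x y z u v w
      have h₁ := congrFun hm ![(x, u), (y, v), (z, w)]
      simp only [Pi.add_apply, Pi.smul_apply, balavoine_one_one, half, key, Pi.zero_apply] at h₁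
      simpa using congrArg Prod.snd h₁
    refine ⟨hβ, hmL, hmR, fun x m => ?_, fun m x => ?_, fun x y m => ?_, fun x y m => ?_,
      fun x y m => ?_⟩
    · simpa [l0, l0', r0, r0', β0] using hc' x 0 0 m
    · simpa [l0, l0', r0, r0', β0] using hc' 0 x m 0
    · have := hm' x y 0 0 0 m
      simp only [hE, l0', r0, β0, b0', α0] at this
      rw [← sub_eq_zero, ← neg_eq_zero, ← this]
      abel
    · have := hm' x 0 y 0 m 0
      simp only [hE, l0, l0', r0, β0, b0, b0', α0] at this
      rw [← sub_eq_zero, ← neg_eq_zero, ← this]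
      abel
    · have := hm' 0 x y m 0 0
      simp only [hE, l0, l0', r0, β0, b0, α0] at this
      rw [← sub_eq_zero, ← neg_eq_zero, ← this]
      abel
  · rw [balavoine_one_one, key', hE0 hB]
    simp
end
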